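/- There exist constants c > 0 and C > 0 and, for every n ∈ ℕ, a finite simple graph G_n with at most C·n vertices (fixed independently of the edge weights and of a, b), such that for all real numbers a < b the following holds: if the edge weights of G_n are independent random variables, each uniform on [a, b], and σ is a uniformly random cut of G_n independent of the weights, then the probability that there exists a 3-flip sequence improving from σ of length at least 2^{c·√n} tends to 1 as n → ∞ (i.e., for every ε > 0 there is N such that for all n ≥ N this probability is at least 1 − ε). -/

import Mathlib

open Finset
open scoped Classical

namespace MaxCut

variable {V : Type*} [Fintype V]

/-- The value of a cut `σ` in graph `G` with weights `X`. -/
noncomputable def cutValue (G : SimpleGraph V) (X : Sym2 V → ℝ) (σ : V → ℝ) : ℝ :=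
  (1 / 2) * ∑ e ∈ Finset.univ.filter (fun e => e ∈ G.edgeSet),
    (1 - Sym2.lift ⟨fun u w => σ u * σ w, fun u w => by ring⟩ e) * X e

/-- Flip the vertices of `S` across the cut. -/
noncomputable def flip (σ : V → ℝ) (S : Finset V) : V → ℝ := fun v => if v ∈ S then -σ v else σ v

/-- The change in cut value caused by flipping all vertices of `S`. -/
noncomputable def impr (G : SimpleGraph V) (X : Sym2 V → ℝ) (σ : V → ℝ) (S : Finset V) : ℝ :=
  cutValue G X (flip σ S) - cutValue G X σ

/-- The cut obtained from `σ` by performing all moves of the flip sequence. -/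
noncomputable def applyList (σ : V → ℝ) : List (Finset V) → (V → ℝ)
  | [] => σ
  | S :: L => applyList (flip σ S) L

/-- A flip sequence is improving from `σ` if each step strictly increases the cut value. -/
def Improving (G : SimpleGraph V) (X : Sym2 V → ℝ) : (V → ℝ) → List (Finset V) → Prop
  | _, [] => True
  | σ, S :: L => 0 < impr G X σ S ∧ Improving G X (flip σ S) L

/-- A cut assigns `1` or `-1` to each vertex. -/
def IsCut (σ : V → ℝ) : Prop := ∀ v, σ v = 1 ∨ σ v = -1

/-- A local optimum: no single-vertex flip is improving. -/
noncomputable def deg (G : SimpleGraph V) (v : V) : ℕ :=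
  (Finset.univ.filter (fun u => G.Adj v u)).card

def IsLocalOpt (G : SimpleGraph V) (X : Sym2 V → ℝ) (σ : V → ℝ) : Prop :=
  ∀ v : V, impr G X σ {v} ≤ 0


open MeasureTheory ProbabilityTheory

/-- The uniform probability measure on the interval `[a, b]`. -/
noncomputable def uniformIcc (a b : ℝ) : Measure ℝ :=
  (volume (Set.Icc a b))⁻¹ • volume.restrict (Set.Icc a b)

/-- Convert a boolean colouring into a `±1`-valued cut. -/
noncomputable def toCut {V : Type*} (f : V → Bool) : V → ℝ := fun v => if f v then 1 else -1

noncomputable def lstep (H : ℕ) (A : Finset ℤ) (d : ℤ) : Finset ℤ :=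
  A ∪ ((A.image (fun x => x + d) ∩ Finset.Ico 0 (H : ℤ)) \ A)

noncomputable def reach (H : ℕ) : (k : ℕ) → (Fin k → ℤ) → Finset ℤ
  | 0, _ => {0}
  | k + 1, w => lstep H (reach H k (Fin.tail w)) (w 0)

lemma lstep_subset (H : ℕ) (A : Finset ℤ) (d : ℤ) (hA : A ⊆ Finset.Ico 0 (H : ℤ)) :
    lstep H A d ⊆ Finset.Ico 0 (H : ℤ) := by
  unfold lstep
  apply Finset.union_subset hA
  exact Finset.sdiff_subset.trans Finset.inter_subset_right

lemma reach_subset (H : ℕ) (hH : 0 < H) (k : ℕ) (w : Fin k → ℤ) :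
    reach H k w ⊆ Finset.Ico 0 (H : ℤ) := by
  induction k with
  | zero => simp [reach, hH]
  | succ k ih => exact lstep_subset _ _ _ (ih _)

lemma reach_zero_mem (H : ℕ) (k : ℕ) (w : Fin k → ℤ) : (0 : ℤ) ∈ reach H k w := by
  induction k with
  | zero => simp [reach]
  | succ k ih => exact Finset.mem_union_left _ (ih _)

lemma reach_sum (H : ℕ) (k : ℕ) (w : Fin k → ℤ) (x : ℤ) (hx : x ∈ reach H k w) :
    ∃ τ : Fin k → ℤ, (∀ i, τ i = 0 ∨ τ i = 1) ∧ ∑ i, τ i * w i = x := by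
  induction k generalizing x with
  | zero => 
    simp [reach] at hx
    exact ⟨fun _ => 0, by simp, by simp [hx]⟩
  | succ k ih =>
    simp only [reach, lstep, Finset.mem_union, Finset.mem_sdiff, Finset.mem_inter,
      Finset.mem_image] at hx
    rcases hx with hx | ⟨⟨⟨y, hy, rfl⟩, -⟩, -⟩
    · obtain ⟨τ, h1, h2⟩ := ih _ _ hx
      refine ⟨Fin.cons 0 τ, ?_, ?_⟩
      · intro i; refine Fin.cases ?_ ?_ i <;> simp [h1]
      · simpa [Fin.sum_univ_succ, Fin.tail] using h2
    · obtain ⟨τ, h1, h2⟩ := ih _ _ hy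
      refine ⟨Fin.cons 1 τ, ?_, ?_⟩
      · intro i; refine Fin.cases ?_ ?_ i <;> simp [h1]
      · simp [Fin.sum_univ_succ, Fin.tail] at h2 ⊢
        linarith

lemma count_diff (g : ℕ) (b : ℤ) (hb : b = 1 ∨ b = -1) (δ : ℤ) (h1 : δ < 3 * g) (h2 : -(3 * g) < δ) :
    g ≤ (Finset.univ.filter (fun a : Fin (4 * g) × Fin (4 * g) =>
      b * (((a.1 : ℕ) : ℤ) - ((a.2 : ℕ) : ℤ)) = δ)).card := by
  have key : ∃ f : Fin g → Fin (4 * g) × Fin (4 * g), Function.Injective f ∧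
      ∀ j, b * ((((f j).1 : ℕ) : ℤ) - (((f j).2 : ℕ) : ℤ)) = δ := by
    rcases le_total 0 (b * δ) with h | h
    · refine ⟨fun j => (⟨j + (b * δ).toNat, ?_⟩, ⟨j, ?_⟩), ?_, ?_⟩
      · have := j.2
        rcases hb with rfl | rfl <;> omega
      · have := j.2; omega
      · intro i j hij
        simp only [Prod.mk.injEq, Fin.mk.injEq] at hij
        exact Fin.ext hij.2
      · intro j
        rcases hb with rfl | rfl <;> simp only [] <;> push_cast <;> omega
    · refine ⟨fun j => (⟨j, ?_⟩, ⟨j + (-(b * δ)).toNat, ?_⟩), ?_, ?_⟩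
      · have := j.2; omega
      · have := j.2
        rcases hb with rfl | rfl <;> omega
      · intro i j hij
        simp only [Prod.mk.injEq, Fin.mk.injEq] at hij
        exact Fin.ext hij.1
      · intro j
        rcases hb with rfl | rfl <;> simp only [] <;> push_cast <;> omega
  obtain ⟨f, hf, hf2⟩ := key
  calc g = (Finset.univ : Finset (Fin g)).card := by simp
    _ ≤ _ := Finset.card_le_card_of_injOn f (fun j _ => by simpa using hf2 j) hf.injOn

lemma new_card (H : ℕ) (A : Finset ℤ) (d : ℤ) :
    ((A.image (fun x => x + d) ∩ Finset.Ico 0 (H : ℤ)) \ A).card =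
      ∑ y ∈ Finset.Ico 0 (H : ℤ) \ A, ∑ x ∈ A, if d = y - x then 1 else 0 := by
  have : ∀ y, (∑ x ∈ A, if d = y - x then 1 else 0) = if y - d ∈ A then 1 else 0 := by
    intro y
    rw [← Finset.sum_ite_eq' A (y - d) (fun _ => 1)]
    apply Finset.sum_congr rfl
    intro x _
    congr 1
    apply propext; constructor <;> intro h <;> omega
  simp_rw [this]
  rw [← Finset.card_filter]
  congr 1
  ext y
  simp only [Finset.mem_sdiff, Finset.mem_inter, Finset.mem_image, Finset.mem_filter]
  constructor
  · rintro ⟨⟨⟨x, hx, rfl⟩, h⟩, h'⟩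
    exact ⟨⟨h, h'⟩, by simpa using hx⟩
  · rintro ⟨⟨h, h'⟩, h''⟩
    exact ⟨⟨⟨y - d, h'', by ring⟩, h⟩, h'⟩

noncomputable def phi (H : ℕ) (A : Finset ℤ) : ℝ := (H : ℝ) / A.card - 1

lemma sum_new (g : ℕ) (b : ℤ) (hb : b = 1 ∨ b = -1) (A : Finset ℤ)
    (hA : A ⊆ Finset.Ico 0 ((3 * g : ℕ) : ℤ)) :
    g * A.card * (3 * g - A.card) ≤ ∑ a : Fin (4 * g) × Fin (4 * g),
      ((A.image (fun x => x + b * (((a.1 : ℕ) : ℤ) - ((a.2 : ℕ) : ℤ))) ∩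
        Finset.Ico 0 ((3 * g : ℕ) : ℤ)) \ A).card := by
  simp_rw [new_card]
  rw [Finset.sum_comm]
  have : ∀ y ∈ Finset.Ico 0 ((3 * g : ℕ) : ℤ) \ A, g * A.card ≤
      ∑ a : Fin (4 * g) × Fin (4 * g), ∑ x ∈ A,
        if b * (((a.1 : ℕ) : ℤ) - ((a.2 : ℕ) : ℤ)) = y - x then 1 else 0 := by
    intro y hy
    rw [Finset.sum_comm, mul_comm, ← smul_eq_mul]
    apply Finset.card_nsmul_le_sum
    intro x hx
    rw [← Finset.card_filter]
    have h1 := Finset.mem_Ico.1 (hA hx)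
    have h2 := Finset.mem_Ico.1 (Finset.mem_sdiff.1 hy).1
    push_cast at h1 h2
    exact count_diff g b hb _ (by linarith) (by linarith)
  have h3 := Finset.card_nsmul_le_sum _ _ _ this
  rw [Finset.card_sdiff_of_subset hA] at h3
  simp only [Int.card_Ico, sub_zero, Int.toNat_natCast, smul_eq_mul] at h3
  rw [mul_comm]
  exact h3

lemma phi_step (g : ℕ) (b : ℤ) (hb : b = 1 ∨ b = -1) (A : Finset ℤ) (h0 : A.Nonempty)
    (hA : A ⊆ Finset.Ico 0 ((3 * g : ℕ) : ℤ)) :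
    ∑ a : Fin (4 * g) × Fin (4 * g),
      phi (3 * g) (lstep (3 * g) A (b * (((a.1 : ℕ) : ℤ) - ((a.2 : ℕ) : ℤ)))) ≤
      (29 / 32 * (4 * g : ℝ) ^ 2) * phi (3 * g) A := by
  have hp : (0 : ℝ) < A.card := by exact_mod_cast h0.card_pos
  have hcard : A.card ≤ 3 * g := by
    have := Finset.card_le_card hA
    rw [Int.card_Ico] at this; omega
  have hs := sum_new g b hb A hA
  set r : Fin (4 * g) × Fin (4 * g) → ℕ := fun a =>
      ((A.image (fun x => x + b * (((a.1 : ℕ) : ℤ) - ((a.2 : ℕ) : ℤ))) ∩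
        Finset.Ico 0 ((3 * g : ℕ) : ℤ)) \ A).card with hr
  have hrA : ∀ a, r a ≤ A.card := fun a =>
    (Finset.card_le_card (Finset.sdiff_subset.trans Finset.inter_subset_left)).trans
      Finset.card_image_le
  have hstep : ∀ a : Fin (4 * g) × Fin (4 * g),
      phi (3 * g) (lstep (3 * g) A (b * (((a.1 : ℕ) : ℤ) - ((a.2 : ℕ) : ℤ)))) ≤
      phi (3 * g) A - (3 * g : ℝ) / (2 * (A.card : ℝ) ^ 2) * r a := by
    intro a
    have hc : (lstep (3 * g) A (b * (((a.1 : ℕ) : ℤ) - ((a.2 : ℕ) : ℤ)))).card =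
        A.card + r a := by
      unfold lstep
      rw [Finset.card_union_of_disjoint Finset.disjoint_sdiff]
    unfold phi
    rw [hc]
    have h1 : (r a : ℝ) ≤ A.card := by exact_mod_cast hrA a
    have h2 : (0 : ℝ) ≤ r a := by positivity
    have h3 : (1 : ℝ) / (A.card + r a) ≤ 1 / A.card - 1 / (2 * (A.card : ℝ) ^ 2) * r a := by
      rw [div_le_iff₀ (by positivity)]
      have : (1 / (A.card : ℝ) - 1 / (2 * (A.card : ℝ) ^ 2) * r a) * (A.card + r a) =
        1 + (r a * (A.card - r a)) / (2 * (A.card : ℝ) ^ 2) := by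
        field_simp; ring
      rw [this]
      have : 0 ≤ (r a * (A.card - r a)) / (2 * (A.card : ℝ) ^ 2) := by
        apply div_nonneg
        · exact mul_nonneg h2 (by linarith)
        · positivity
      linarith
    have h4 := mul_le_mul_of_nonneg_left h3 (show (0 : ℝ) ≤ 3 * g by positivity)
    push_cast
    have e1 : (3 * g : ℝ) * (1 / (A.card + r a)) = 3 * g / (A.card + r a) := by ring
    have e2 : (3 * g : ℝ) * (1 / A.card - 1 / (2 * (A.card : ℝ) ^ 2) * r a) =
      3 * g / A.card - 3 * g / (2 * (A.card : ℝ) ^ 2) * r a := by ring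
    rw [e1, e2] at h4
    linarith
  refine (Finset.sum_le_sum fun a _ => hstep a).trans ?_
  rw [Finset.sum_sub_distrib, ← Finset.mul_sum, Finset.sum_const]
  have hs' : (g : ℝ) * A.card * (3 * g - A.card) ≤ ∑ a, (r a : ℝ) := by
    have : ((g * A.card * (3 * g - A.card) : ℕ) : ℝ) ≤ ((∑ a, r a : ℕ) : ℝ) := by
      exact_mod_cast hs
    rw [Nat.cast_mul, Nat.cast_sub hcard] at this
    push_cast at this
    exact this
  have h5 := mul_le_mul_of_nonneg_left hs'
    (show (0 : ℝ) ≤ (3 * g : ℝ) / (2 * (A.card : ℝ) ^ 2) by positivity)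
  have h6 : (3 * g : ℝ) / (2 * (A.card : ℝ) ^ 2) * ((g : ℝ) * A.card * (3 * g - A.card)) =
      3 / 32 * (4 * g : ℝ) ^ 2 * phi (3 * g) A := by
    unfold phi
    push_cast
    field_simp
    ring
  simp only [Finset.card_univ, Fintype.card_prod, Fintype.card_fin, nsmul_eq_mul]
  push_cast
  nlinarith

/-- difference vector with signs -/
def dvec (g k : ℕ) (b : Fin k → ℤ) (w : Fin k → Fin (4 * g) × Fin (4 * g)) : Fin k → ℤ :=
  fun i => b i * ((((w i).1 : ℕ) : ℤ) - (((w i).2 : ℕ) : ℤ))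

lemma phi_sum (g : ℕ) (hg : 0 < g) (k : ℕ) (b : Fin k → ℤ) (hb : ∀ i, b i = 1 ∨ b i = -1) :
    ∑ w : Fin k → Fin (4 * g) × Fin (4 * g), phi (3 * g) (reach (3 * g) k (dvec g k b w)) ≤
      (29 / 32 * (4 * g : ℝ) ^ 2) ^ k * (3 * g) := by
  induction k with
  | zero => simp [phi, reach]
  | succ k ih =>
    rw [← (Fin.consEquiv (fun _ => Fin (4 * g) × Fin (4 * g))).sum_comp, Fintype.sum_prod_type_right]
    have : ∀ w : Fin k → Fin (4 * g) × Fin (4 * g), 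
      ∑ a : Fin (4 * g) × Fin (4 * g), phi (3 * g) (reach (3 * g) (k + 1) (dvec g (k + 1) b
        (Fin.consEquiv (fun _ => Fin (4 * g) × Fin (4 * g)) (a, w)))) ≤
      (29 / 32 * (4 * g : ℝ) ^ 2) * phi (3 * g) (reach (3 * g) k (dvec g k (Fin.tail b) w)) := by
      intro w
      exact phi_step g (b 0) (hb 0) (reach (3 * g) k (dvec g k (Fin.tail b) w))
        ⟨0, reach_zero_mem _ _ _⟩ (reach_subset _ (by omega) _ _)
    refine (Finset.sum_le_sum fun w _ => this w).trans ?_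
    rw [← Finset.mul_sum, pow_succ' (29 / 32 * (4 * g : ℝ) ^ 2) k, mul_assoc _ (_ ^ k) _]
    exact mul_le_mul_of_nonneg_left (ih (Fin.tail b) (fun i => hb _)) (by positivity)

lemma bad_count (g : ℕ) (hg : 0 < g) (k : ℕ) (b : Fin k → ℤ) (hb : ∀ i, b i = 1 ∨ b i = -1) :
    ((Finset.univ.filter (fun w : Fin k → Fin (4 * g) × Fin (4 * g) =>
      reach (3 * g) k (dvec g k b w) ≠ Finset.Ico 0 ((3 * g : ℕ) : ℤ))).card : ℝ) ≤
      (29 / 32 * (4 * g : ℝ) ^ 2) ^ k * (3 * g) ^ 2 := by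
  have h := phi_sum g hg k b hb
  have hge : ∀ w : Fin k → Fin (4 * g) × Fin (4 * g),
      (if reach (3 * g) k (dvec g k b w) ≠ Finset.Ico 0 ((3 * g : ℕ) : ℤ) then (1 : ℝ) else 0) ≤
      (3 * g) * phi (3 * g) (reach (3 * g) k (dvec g k b w)) := by
    intro w
    have hsub := reach_subset (3 * g) (by omega) k (dvec g k b w)
    set A := reach (3 * g) k (dvec g k b w) with hA
    have h0 : A.Nonempty := ⟨0, reach_zero_mem _ _ _⟩
    have hp : (0 : ℝ) < A.card := by exact_mod_cast h0.card_pos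
    have hg' : (0 : ℝ) < g := by exact_mod_cast hg
    have hcard : A.card ≤ 3 * g := by
      have := Finset.card_le_card hsub
      rw [Int.card_Ico] at this; omega
    have hcR : (A.card : ℝ) ≤ 3 * g := by exact_mod_cast hcard
    have e : phi (3 * g) A = (3 * g - A.card) / A.card := by
      unfold phi; push_cast; field_simp
    rw [e]
    split_ifs with hne
    · have hlt : A.card < 3 * g := by
        have := Finset.card_lt_card (lt_of_le_of_ne hsub hne)
        rw [Int.card_Ico] at this; omega
      have hlt' : (A.card : ℝ) + 1 ≤ 3 * g := by exact_mod_cast hlt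
      rw [mul_div_assoc', le_div_iff₀ hp]
      nlinarith
    · apply mul_nonneg (by positivity)
      apply div_nonneg (by linarith) hp.le
  rw [Finset.card_filter]
  push_cast
  refine (Finset.sum_le_sum fun w _ => hge w).trans ?_
  rw [← Finset.mul_sum]
  have := mul_le_mul_of_nonneg_left h (show (0 : ℝ) ≤ 3 * g by positivity)
  nlinarith

def fam (k t : ℕ) (sg : ℤ) : Fin k → ℤ := fun i => sg * (if i.val < t then -1 else 1)

lemma fam_sign (k t : ℕ) (sg : ℤ) (h : sg = 1 ∨ sg = -1) (i : Fin k) :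
    fam k t sg i = 1 ∨ fam k t sg i = -1 := by
  unfold fam
  rcases h with rfl | rfl <;> split_ifs <;> simp

def GoodU (g k : ℕ) (w : Fin k → Fin (4 * g) × Fin (4 * g)) : Prop :=
  ∀ t ≤ k, ∀ sg : ℤ, (sg = 1 ∨ sg = -1) →
    reach (3 * g) k (dvec g k (fam k t sg) w) = Finset.Ico 0 ((3 * g : ℕ) : ℤ)

lemma goodU_count (g : ℕ) (hg : 0 < g) (k : ℕ) :
    ((Finset.univ.filter (fun w : Fin k → Fin (4 * g) × Fin (4 * g) => ¬ GoodU g k w)).card : ℝ) ≤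
      2 * (k + 1) * ((29 / 32 * (4 * g : ℝ) ^ 2) ^ k * (3 * g) ^ 2) := by
  have hsub : (Finset.univ.filter (fun w : Fin k → Fin (4 * g) × Fin (4 * g) => ¬ GoodU g k w)) ⊆
      (Finset.range (k + 1) ×ˢ ({1, -1} : Finset ℤ)).biUnion (fun p =>
        Finset.univ.filter (fun w : Fin k → Fin (4 * g) × Fin (4 * g) =>
          reach (3 * g) k (dvec g k (fam k p.1 p.2) w) ≠ Finset.Ico 0 ((3 * g : ℕ) : ℤ))) := by
    intro w hw
    have hw := (Finset.mem_filter.1 hw).2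
    unfold GoodU at hw
    push Not at hw
    obtain ⟨t, ht, sg, hsg, h⟩ := hw
    simp only [Finset.mem_biUnion, Finset.mem_product, Finset.mem_range, Finset.mem_insert,
      Finset.mem_singleton, Finset.mem_filter, Finset.mem_univ, true_and]
    exact ⟨(t, sg), ⟨by simp only []; omega, hsg⟩, h⟩
  have h1 := (Finset.card_le_card hsub).trans Finset.card_biUnion_le
  have h2 : ((Finset.univ.filter (fun w : Fin k → Fin (4 * g) × Fin (4 * g) =>
      ¬ GoodU g k w)).card : ℝ) ≤ ∑ p ∈ (Finset.range (k + 1) ×ˢ ({1, -1} : Finset ℤ)),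
        ((Finset.univ.filter (fun w : Fin k → Fin (4 * g) × Fin (4 * g) =>
          reach (3 * g) k (dvec g k (fam k p.1 p.2) w) ≠
            Finset.Ico 0 ((3 * g : ℕ) : ℤ))).card : ℝ) := by
    exact_mod_cast h1
  refine h2.trans ((Finset.sum_le_card_nsmul _ _ _ (fun p hp => bad_count g hg k _ ?_)).trans ?_)
  · simp only [Finset.mem_product, Finset.mem_insert, Finset.mem_singleton] at hp
    exact fam_sign _ _ _ hp.2
  · rw [Finset.card_product]
    simp
    apply le_of_eq; ring

lemma exists_base (k : ℕ) (e : Fin k → ℤ) (Gz : ℤ) (he : ∀ i, |e i| ≤ Gz) (hG : 0 ≤ Gz) :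
    ∃ t ≤ k, ∃ sg : ℤ, (sg = 1 ∨ sg = -1) ∧ 0 ≤ ∑ i, fam k t sg i * e i ∧
      ∑ i, fam k t sg i * e i ≤ Gz := by
  set Y : ℕ → ℤ := fun t => ∑ i, fam k t 1 i * e i with hY
  have hneg : ∀ t, ∑ i, fam k t (-1) i * e i = - Y t := by
    intro t
    rw [hY, ← Finset.sum_neg_distrib]
    apply Finset.sum_congr rfl
    intro i _
    unfold fam; ring
  have hk : Y k = - Y 0 := by
    rw [hY, ← Finset.sum_neg_distrib]
    apply Finset.sum_congr rfl
    intro i _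
    unfold fam; simp
  have hstep : ∀ t, t < k → |Y (t + 1) - Y t| ≤ 2 * Gz := by
    intro t ht
    have : Y (t + 1) - Y t = -2 * e ⟨t, ht⟩ := by
      rw [hY, ← Finset.sum_sub_distrib, Finset.sum_eq_single ⟨t, ht⟩]
      · simp [fam]; ring
      · intro i _ hi
        have : i.val ≠ t := fun h => hi (Fin.ext h)
        unfold fam
        by_cases h : i.val < t
        · simp [h, Nat.lt_succ_of_lt h]
        · have : ¬ i.val < t + 1 := by omega
          simp [h, this]
      · simp
    rw [this, abs_mul]
    have := he ⟨t, ht⟩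
    simp; linarith
  have key : ∃ t ≤ k, |Y t| ≤ Gz := by
    by_contra hcon
    push Not at hcon
    have hpos : ∀ t ≤ k, (0 < Y 0 ↔ 0 < Y t) := by
      intro t
      induction t with
      | zero => simp
      | succ t ih =>
        intro ht
        rw [ih (by omega)]
        have h1 := hcon t (by omega)
        have h2 := hcon (t + 1) ht
        have h3 := hstep t (by omega)
        rw [abs_le] at h3
        rw [lt_abs] at h1 h2
        constructor <;> intro h <;> omega
    have h1 := hpos k le_rfl
    have h2 := hcon 0 (by omega)
    rw [hk] at h1
    rw [lt_abs] at h2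
    omega
  obtain ⟨t, ht, h⟩ := key
  rw [abs_le] at h
  rcases le_total 0 (Y t) with h0 | h0
  · exact ⟨t, ht, 1, Or.inl rfl, h0, h.2⟩
  · exact ⟨t, ht, -1, Or.inr rfl, by rw [hneg]; omega, by rw [hneg]; omega⟩

lemma star_dense (g k : ℕ) (hkg : k + 2 < g) (w : Fin k → Fin (4 * g) × Fin (4 * g))
    (hw : GoodU g k w) (a δ : ℝ) (hδ : 0 < δ) (X : Fin k → Bool → ℝ)
    (h1 : ∀ i, X i true ∈ Set.Ico (a + ((w i).1 : ℕ) * δ) (a + (((w i).1 : ℕ) + 1) * δ))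
    (h2 : ∀ i, X i false ∈ Set.Ico (a + ((w i).2 : ℕ) * δ) (a + (((w i).2 : ℕ) + 1) * δ))
    (τ : ℝ) (hτ0 : 0 ≤ τ) (hτ : τ ≤ g * δ) :
    ∃ s : Fin k → ℝ, (∀ i, s i = 1 ∨ s i = -1) ∧ τ ≤ ∑ i, s i * (X i true - X i false) ∧
      ∑ i, s i * (X i true - X i false) ≤ τ + δ * (2 * k + 2) := by
  set e : Fin k → ℤ := fun i => (((w i).1 : ℕ) : ℤ) - (((w i).2 : ℕ) : ℤ) with he
  obtain ⟨t, ht, sg, hsg, hy0, hy1⟩ := exists_base k e (4 * g) (by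
    intro i
    have := (w i).1.2
    have := (w i).2.2
    rw [abs_le]; simp only [he]; constructor <;> omega) (by positivity)
  set b := fam k t sg with hb
  set y := ∑ i, b i * e i with hy
  have hreach := hw t ht sg hsg
  set n0 : ℤ := ⌈τ / δ⌉ + k with hn0
  have hc1 : τ / δ ≤ ⌈τ / δ⌉ := Int.le_ceil _
  have hc2 : (⌈τ / δ⌉ : ℝ) < τ / δ + 1 := Int.ceil_lt_add_one _
  have hc0 : 0 ≤ ⌈τ / δ⌉ := Int.ceil_nonneg (by positivity)
  have hcg : ⌈τ / δ⌉ ≤ g := by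
    apply Int.ceil_le.2
    rw [div_le_iff₀ hδ]; exact_mod_cast hτ
  obtain ⟨n, q, hn, hq⟩ : ∃ n q : ℤ, (n = n0 ∨ n = n0 + 1) ∧ n + y = 2 * q := by
    rcases Int.even_or_odd' (n0 + y) with ⟨c, hc | hc⟩
    · exact ⟨n0, c, Or.inl rfl, hc⟩
    · exact ⟨n0 + 1, c + 1, Or.inr rfl, by omega⟩
  have hqmem : q ∈ reach (3 * g) k (dvec g k b w) := by
    rw [hreach, Finset.mem_Ico]
    push_cast
    omega
  obtain ⟨T, hT, hTs⟩ := reach_sum _ _ _ _ hqmem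
  have hTs' : ∑ i, T i * (b i * e i) = q := hTs
  have hbs : ∀ i, b i = 1 ∨ b i = -1 := fam_sign _ _ _ hsg
  have hsign : ∀ i, b i * (2 * T i - 1) = 1 ∨ b i * (2 * T i - 1) = -1 := by
    intro i
    rcases hbs i with h | h <;> rcases hT i with h' | h' <;> rw [h, h'] <;> simp
  have hsume : ∑ i, (b i * (2 * T i - 1)) * e i = n := by
    have : ∑ i, (b i * (2 * T i - 1)) * e i = 2 * ∑ i, T i * (b i * e i) - y := by
      rw [hy, Finset.mul_sum, ← Finset.sum_sub_distrib]
      apply Finset.sum_congr rfl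
      intro i _; ring
    rw [this, hTs']; omega
  set s : Fin k → ℝ := fun i => ((b i * (2 * T i - 1) : ℤ) : ℝ) with hs
  have hsR : ∀ i, s i = 1 ∨ s i = -1 := by
    intro i
    rcases hsign i with h | h
    · left; simp only [hs, h]; simp
    · right; simp only [hs, h]; simp
  have hsumR : ∑ i, s i * (e i : ℝ) = n := by
    rw [← hsume]; push_cast; apply Finset.sum_congr rfl; intro i _; simp only [hs]; push_cast; ring
  have herr : |∑ i, s i * (X i true - X i false) - δ * n| ≤ δ * k := by
    rw [← hsumR, Finset.mul_sum, ← Finset.sum_sub_distrib]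
    refine (Finset.abs_sum_le_sum_abs _ _).trans ?_
    have : ∀ i ∈ (Finset.univ : Finset (Fin k)),
        |s i * (X i true - X i false) - δ * (s i * (e i : ℝ))| ≤ δ := by
      intro i _
      have a1 := h1 i
      have a2 := h2 i
      simp only [Set.mem_Ico] at a1 a2
      have e1 : s i * (X i true - X i false) - δ * (s i * (e i : ℝ)) =
        s i * (X i true - X i false - δ * (e i : ℝ)) := by ring
      have e2 : |s i| = 1 := by rcases hsR i with h | h <;> rw [h] <;> simp
      rw [e1, abs_mul, e2, one_mul, abs_le]
      simp only [he]
      push_cast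
      constructor <;> nlinarith
    refine (Finset.sum_le_card_nsmul _ _ _ this).trans ?_
    simp [mul_comm]
  rw [abs_le] at herr
  have hnl : τ / δ + k ≤ n := by
    have : n0 ≤ n := by omega
    have : (n0 : ℝ) ≤ n := by exact_mod_cast this
    rw [hn0] at this; push_cast at this; linarith
  have hnu : (n : ℝ) ≤ τ / δ + k + 2 := by
    have : n ≤ n0 + 1 := by omega
    have : (n : ℝ) ≤ n0 + 1 := by exact_mod_cast this
    rw [hn0] at this; push_cast at this; linarith
  have hm : δ * (τ / δ) = τ := by field_simp
  refine ⟨s, hsR, ?_, ?_⟩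
  · have := mul_le_mul_of_nonneg_left hnl hδ.le
    nlinarith [herr.1]
  · have := mul_le_mul_of_nonneg_left hnu hδ.le
    nlinarith [herr.2]

set_option linter.unusedSectionVars false
abbrev VT (St Lf Fu : Type) := St ⊕ (St × Lf) ⊕ (Fu × Bool)
abbrev IT (St Lf Fu : Type) := (St × Lf) ⊕ Fu

def pp {St Lf Fu : Type} : IT St Lf Fu → VT St Lf Fu
  | Sum.inl x => Sum.inl x.1
  | Sum.inr e => Sum.inr (Sum.inr (e, false))
def qq {St Lf Fu : Type} : IT St Lf Fu → VT St Lf Fu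
  | Sum.inl x => Sum.inr (Sum.inl x)
  | Sum.inr e => Sum.inr (Sum.inr (e, true))

def edg {St Lf Fu V : Type} (v : VT St Lf Fu ≃ V) (i : IT St Lf Fu) : Sym2 V :=
  s(v (pp i), v (qq i))

def gr {St Lf Fu V : Type} (v : VT St Lf Fu ≃ V) : SimpleGraph V :=
  SimpleGraph.fromEdgeSet (Set.range (edg v))

section det
variable {St Lf Fu W : Type} (v : VT St Lf Fu ≃ W)

lemma edg_inj : Function.Injective (edg v) := by
  intro i j h
  unfold edg at h
  rw [Sym2.eq_iff] at h
  simp only [v.injective.eq_iff] at h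
  rcases i with ⟨s, l⟩ | e <;> rcases j with ⟨s', l'⟩ | e' <;>
    simp_all [pp, qq]

lemma edgeSet_gr : (gr v).edgeSet = Set.range (edg v) := by
  unfold gr
  rw [SimpleGraph.edgeSet_fromEdgeSet]
  rw [sdiff_eq_left, Set.disjoint_left]
  rintro _ ⟨i, rfl⟩ h
  rcases i with ⟨s, l⟩ | e <;> simp [edg, pp, qq] at h

lemma edg_mem (i : IT St Lf Fu) : edg v i ∈ (gr v).edgeSet := by
  rw [edgeSet_gr]; exact ⟨i, rfl⟩

variable [Fintype St] [Fintype Lf] [Fintype Fu] [Fintype W]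

lemma cutValue_gr (X : Sym2 W → ℝ) (σ : W → ℝ) :
    cutValue (gr v) X σ = (1 / 2) * ∑ i, (1 - σ (v (pp i)) * σ (v (qq i))) * X (edg v i) := by
  unfold cutValue
  congr 1
  have : (Finset.univ.filter (fun e => e ∈ (gr v).edgeSet)) =
      Finset.univ.image (edg v) := by
    ext e
    rw [Finset.mem_filter, edgeSet_gr]
    simp
  rw [this, Finset.sum_image (fun _ _ _ _ h => edg_inj v h)]
  rfl

lemma impr_gr (X : Sym2 W → ℝ) (σ : W → ℝ) (S : Finset W) :
    impr (gr v) X σ S = ∑ i, if (v (pp i) ∈ S ↔ v (qq i) ∈ S) then 0 else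
      σ (v (pp i)) * σ (v (qq i)) * X (edg v i) := by
  unfold impr
  rw [cutValue_gr, cutValue_gr, ← mul_sub, ← Finset.sum_sub_distrib, Finset.mul_sum]
  apply Finset.sum_congr rfl
  intro i _
  unfold flip
  by_cases h1 : v (pp i) ∈ S <;> by_cases h2 : v (qq i) ∈ S <;> simp [h1, h2] <;> ring

def cen (s : St) : W := v (Sum.inl s)
def leaf (s : St) (j : Lf) : W := v (Sum.inr (Sum.inl (s, j)))
def fu (e : Fu) (c : Bool) : W := v (Sum.inr (Sum.inr (e, c)))
def pr (σ : W → ℝ) (s : St) (j : Lf) : ℝ := σ (cen v s) * σ (leaf v s j)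
def fpr (σ : W → ℝ) (e : Fu) : ℝ := σ (fu v e false) * σ (fu v e true)

lemma imprC (X : Sym2 W → ℝ) (σ : W → ℝ) (C : Finset St) :
    impr (gr v) X σ (C.image (cen v)) =
      ∑ s ∈ C, ∑ j, pr v σ s j * X (edg v (Sum.inl (s, j))) := by
  rw [impr_gr, Fintype.sum_sum_type, Fintype.sum_prod_type]
  have h2 : ∑ e : Fu, (if (v (pp (Sum.inr e : IT St Lf Fu)) ∈ C.image (cen v) ↔
      v (qq (Sum.inr e : IT St Lf Fu)) ∈ C.image (cen v)) then (0:ℝ) else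
      σ (v (pp (Sum.inr e : IT St Lf Fu))) * σ (v (qq (Sum.inr e : IT St Lf Fu))) * X (edg v (Sum.inr e : IT St Lf Fu))) = 0 := by
    apply Finset.sum_eq_zero
    intro e _
    simp [pp, qq, cen]
  rw [h2, add_zero, ← Finset.sum_subset (Finset.subset_univ C)]
  · apply Finset.sum_congr rfl
    intro s hs
    apply Finset.sum_congr rfl
    intro j _
    simp [pp, qq, cen, pr, leaf, hs]
  · intro s _ hs
    apply Finset.sum_eq_zero
    intro j _
    simp [pp, qq, cen, hs]

lemma imprL (X : Sym2 W → ℝ) (σ : W → ℝ) (s : St) (j : Lf) (e e' : Fu) (he : e ≠ e') :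
    impr (gr v) X σ {leaf v s j, fu v e false, fu v e' false} =
      pr v σ s j * X (edg v (Sum.inl (s, j))) + fpr v σ e * X (edg v (Sum.inr e))
       + fpr v σ e' * X (edg v (Sum.inr e')) := by
  rw [impr_gr, Fintype.sum_sum_type, add_assoc]
  congr 1
  · rw [Finset.sum_eq_single (s, j)]
    · simp [pp, qq, leaf, fu, pr, cen]
    · intro x _ hx
      simp [pp, qq, leaf, fu, hx]
    · simp
  · rw [← Finset.sum_pair (f := fun e => fpr v σ e * X (edg v (Sum.inr e))) he,
      ← Finset.sum_subset (Finset.subset_univ {e, e'})]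
    · apply Finset.sum_congr rfl
      intro x hx
      simp only [Finset.mem_insert, Finset.mem_singleton] at hx
      rcases hx with rfl | rfl <;> simp [pp, qq, leaf, fu, fpr]
    · intro x _ hx
      simp only [Finset.mem_insert, Finset.mem_singleton, not_or] at hx
      simp [pp, qq, leaf, fu, hx.1, hx.2]

lemma pr_flipC (σ : W → ℝ) (C : Finset St) (s : St) (j : Lf) :
    pr v (flip σ (C.image (cen v))) s j = if s ∈ C then - pr v σ s j else pr v σ s j := by
  unfold pr flip
  by_cases h : s ∈ C <;> simp [h, cen, leaf]

lemma applyList_append (σ : W → ℝ) (L₁ L₂ : List (Finset W)) :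
    applyList σ (L₁ ++ L₂) = applyList (applyList σ L₁) L₂ := by
  induction L₁ generalizing σ with
  | nil => rfl
  | cons S L ih => exact ih _

lemma improving_append (G : SimpleGraph W) (X : Sym2 W → ℝ) (σ : W → ℝ) (L₁ L₂ : List (Finset W))
    (h1 : Improving G X σ L₁) (h2 : Improving G X (applyList σ L₁) L₂) :
    Improving G X σ (L₁ ++ L₂) := by
  induction L₁ generalizing σ with
  | nil => exact h2
  | cons S L ih => exact ⟨h1.1, ih _ h1.2 h2⟩

lemma isCut_flip (σ : W → ℝ) (h : IsCut σ) (S : Finset W) : IsCut (flip σ S) := by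
  intro x
  unfold flip
  rcases h x with h | h <;> split_ifs <;> simp [h]

lemma phase1 (X : Sym2 W → ℝ) (B : ℝ) (hB : ∀ s j, |X (edg v (Sum.inl (s, j)))| ≤ B)
    (d : St → Lf → ℝ) (hd : ∀ s j, d s j = 1 ∨ d s j = -1) (n : ℕ) :
    ∀ (σ : W → ℝ) (_ : IsCut σ) (Γ : Finset Fu) (_ : 2 * n ≤ Γ.card)
      (_ : ∀ e ∈ Γ, B / 2 < fpr v σ e * X (edg v (Sum.inr e)))
      (_ : (Finset.univ.filter (fun x : St × Lf => pr v σ x.1 x.2 ≠ d x.1 x.2)).card ≤ n),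
      ∃ L : List (Finset W), (∀ S ∈ L, S.card ≤ 3) ∧ Improving (gr v) X σ L ∧
        ∀ s j, pr v (applyList σ L) s j = d s j := by
  induction n with
  | zero =>
    intro σ _ Γ _ _ h
    refine ⟨[], by simp, trivial, ?_⟩
    intro s j
    rw [Nat.le_zero, Finset.card_eq_zero, Finset.filter_eq_empty_iff] at h
    have := h (Finset.mem_univ (s, j))
    simpa [applyList] using this
  | succ n ih =>
    intro σ hσ Γ hΓ hg h
    by_cases hW : ∀ s j, pr v σ s j = d s j
    · exact ⟨[], by simp, trivial, hW⟩
    push Not at hW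
    obtain ⟨s, j, hsj⟩ := hW
    obtain ⟨e, he, e', he', hne⟩ := Finset.one_lt_card.1 (show 1 < Γ.card by omega)
    set S : Finset W := {leaf v s j, fu v e false, fu v e' false} with hS
    have hpr : ∀ s' j', pr v (flip σ S) s' j' =
        if s' = s ∧ j' = j then - pr v σ s' j' else pr v σ s' j' := by
      intro s' j'
      unfold pr flip
      by_cases hh : s' = s ∧ j' = j
      · obtain ⟨rfl, rfl⟩ := hh
        simp [hS, cen, leaf, fu]
      · simp [hS, cen, leaf, fu, hh]
    have hneg : pr v (flip σ S) s j = d s j := by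
      rw [hpr]
      simp only [and_self, if_true]
      have h1 : pr v σ s j = 1 ∨ pr v σ s j = -1 := by
        unfold pr
        rcases hσ (cen v s) with h | h <;> rcases hσ (leaf v s j) with h' | h' <;> simp [h, h']
      rcases h1 with h1 | h1 <;> rcases hd s j with h2 | h2 <;> simp_all
    obtain ⟨L, hL1, hL2, hL3⟩ := ih (flip σ S) (isCut_flip σ hσ S) ((Γ.erase e).erase e')
      (by
        rw [Finset.card_erase_of_mem (Finset.mem_erase.2 ⟨hne.symm, he'⟩),
          Finset.card_erase_of_mem he]
        omega)
      (by
        intro x hx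
        simp only [Finset.mem_erase] at hx
        have := hg x hx.2.2
        have h1 : fpr v (flip σ S) x = fpr v σ x := by
          unfold fpr flip
          simp [hS, leaf, fu, hx.1, hx.2.1]
        rw [h1]; exact this)
      (by
        have hlt : (Finset.univ.filter (fun x : St × Lf => pr v (flip σ S) x.1 x.2 ≠ d x.1 x.2)) ⊂
            (Finset.univ.filter (fun x : St × Lf => pr v σ x.1 x.2 ≠ d x.1 x.2)) := by
          rw [Finset.ssubset_iff_of_subset]
          · refine ⟨(s, j), ?_, ?_⟩
            · simpa using hsj
            · simpa using hneg
          · intro x hx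
            simp only [Finset.mem_filter, Finset.mem_univ, true_and] at hx ⊢
            rw [hpr] at hx
            by_cases hh : x.1 = s ∧ x.2 = j
            · rw [hh.1, hh.2]; exact hsj
            · rwa [if_neg hh] at hx
        have := Finset.card_lt_card hlt
        omega)
    refine ⟨S :: L, ?_, ⟨?_, hL2⟩, hL3⟩
    · intro T hT
      rcases List.mem_cons.1 hT with rfl | hT
      · exact Finset.card_le_three
      · exact hL1 T hT
    · rw [hS, imprL v X σ s j e e' hne]
      have a1 := hg e he
      have a2 := hg e' he'
      have a3 : |pr v σ s j * X (edg v (Sum.inl (s, j)))| ≤ B := by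
        have h1 : |pr v σ s j| = 1 := by
          unfold pr
          rcases hσ (cen v s) with h | h <;> rcases hσ (leaf v s j) with h' | h' <;> simp [h, h']
        rw [abs_mul, h1, one_mul]; exact hB s j
      rw [abs_le] at a3
      linarith [a3.1]

end det

section det2
variable {Lf Fu W : Type} {m : ℕ} [Fintype Lf] [Fintype Fu] [Fintype W]
  (v : VT (Fin m × Bool) Lf Fu ≃ W)

lemma cen_inj : Function.Injective (cen v) := by
  intro x y h
  simpa [cen] using h

lemma phase2 (X : Sym2 W → ℝ) (t : Fin m × Bool → Lf → ℝ)
    (f : Fin m × Bool → ℝ) (hf : ∀ s, f s = ∑ j, t s j * X (edg v (Sum.inl (s, j))))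
    (hpos : ∀ s, 0 < f s)
    (hsup : ∀ (l : ℕ) (h : l + 1 < m) (c : Bool),
      f (⟨l, by omega⟩, false) + f (⟨l, by omega⟩, true) < f (⟨l + 1, h⟩, c)) (l : ℕ) :
    ∀ (h : l < m) (c : Bool) (σ : W → ℝ)
      (_ : ∀ j, pr v σ (⟨l, h⟩, c) j = t (⟨l, h⟩, c) j)
      (_ : ∀ l' (h' : l' < m) (_ : l' < l) c' j, pr v σ (⟨l', h'⟩, c') j = - t (⟨l', h'⟩, c') j),
      ∃ L : List (Finset W), (∀ S ∈ L, S.card ≤ 3) ∧ Improving (gr v) X σ L ∧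
        2 ^ (l + 1) ≤ L.length + 1 ∧
        applyList σ L = flip σ (({(⟨l, h⟩, c)} : Finset (Fin m × Bool)).image (cen v)) := by
  induction l with
  | zero =>
    intro h c σ hσ _
    refine ⟨[({(⟨0, h⟩, c)} : Finset (Fin m × Bool)).image (cen v)], ?_, ⟨?_, trivial⟩, ?_, rfl⟩
    · intro S hS
      rw [List.mem_singleton.1 hS]
      exact Finset.card_image_le.trans (by simp)
    · rw [imprC, Finset.sum_singleton]
      simp only [hσ]
      rw [← hf]
      exact hpos _
    · simp
  | succ l ih =>
    intro h c σ hσ hlow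
    have hl : l < m := by omega
    set A : Fin m × Bool := (⟨l + 1, h⟩, c) with hA
    set B0 : Fin m × Bool := (⟨l, hl⟩, false) with hB0
    set B1 : Fin m × Bool := (⟨l, hl⟩, true) with hB1
    have hA0 : A ≠ B0 := by simp [hA, hB0]
    have hA1 : A ≠ B1 := by simp [hA, hB1]
    have h01 : B0 ≠ B1 := by simp [hB1, hB0]
    set S : Finset W := ({A, B0, B1} : Finset (Fin m × Bool)).image (cen v) with hS
    set σ1 := flip σ S with hσ1
    obtain ⟨L0, c0, i0, n0, e0⟩ := ih hl false σ1
      (by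
        intro j
        rw [hσ1, hS, pr_flipC, if_pos (by simp [hB0]), hlow l hl (by omega)]
        ring)
      (by
        intro l' h' hlt c' j
        rw [hσ1, hS, pr_flipC, if_neg, hlow l' h' (by omega)]
        simp only [hA, hB0, hB1, Finset.mem_insert, Finset.mem_singleton, Prod.mk.injEq,
          Fin.mk.injEq]
        omega)
    set σ2 := applyList σ1 L0 with hσ2
    obtain ⟨L1, c1, i1, n1, e1⟩ := ih hl true σ2
      (by
        intro j
        rw [e0, pr_flipC, if_neg (by simp), hσ1, hS, pr_flipC, if_pos (by simp [hB1]),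
          hlow l hl (by omega)]
        ring)
      (by
        intro l' h' hlt c' j
        rw [e0, pr_flipC, if_neg, hσ1, hS, pr_flipC, if_neg, hlow l' h' (by omega)]
        · simp only [hA, hB0, hB1, Finset.mem_insert, Finset.mem_singleton, Prod.mk.injEq,
            Fin.mk.injEq]
          omega
        · simp only [Finset.mem_singleton, Prod.mk.injEq, Fin.mk.injEq]
          omega)
    refine ⟨S :: (L0 ++ L1), ?_, ⟨?_, improving_append _ _ _ _ _ i0 i1⟩, ?_, ?_⟩
    · intro T hT
      rcases List.mem_cons.1 hT with rfl | hT
      · exact Finset.card_image_le.trans Finset.card_le_three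
      · rcases List.mem_append.1 hT with hT | hT
        · exact c0 T hT
        · exact c1 T hT
    · rw [hS, imprC, Finset.sum_insert (by simp [hA0, hA1]), Finset.sum_pair h01]
      have q0 : ∑ j, pr v σ B0 j * X (edg v (Sum.inl (B0, j))) = - f B0 := by
        rw [hf, ← Finset.sum_neg_distrib]
        apply Finset.sum_congr rfl
        intro j _
        rw [hB0, hlow l hl (by omega)]; ring
      have q1 : ∑ j, pr v σ B1 j * X (edg v (Sum.inl (B1, j))) = - f B1 := by
        rw [hf, ← Finset.sum_neg_distrib]
        apply Finset.sum_congr rfl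
        intro j _
        rw [hB1, hlow l hl (by omega)]; ring
      have q2 : ∑ j, pr v σ A j * X (edg v (Sum.inl (A, j))) = f A := by
        rw [hf]
        apply Finset.sum_congr rfl
        intro j _
        rw [hσ]
      rw [q0, q1, q2]
      have := hsup l h c
      linarith
    · simp only [List.length_cons, List.length_append]
      rw [pow_succ]; omega
    · change applyList σ1 (L0 ++ L1) = _
      rw [applyList_append, ← hσ2, e1, e0, hσ1, hS]
      funext x
      unfold flip
      by_cases x1 : x = cen v B0
      · subst x1
        simp [(cen_inj v).eq_iff, hA0.symm, h01, hB0.symm, hB1.symm]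
      · by_cases x2 : x = cen v B1
        · subst x2
          simp [(cen_inj v).eq_iff, hA1.symm, h01.symm, hB0.symm, hB1.symm]
        · simp [x1, x2, ← hB0, ← hB1]

lemma det_main (hm : 0 < m) (X : Sym2 W → ℝ) (σ : W → ℝ) (hσ : IsCut σ) (B : ℝ)
    (hB : ∀ s j, |X (edg v (Sum.inl (s, j)))| ≤ B)
    (Γ : Finset Fu) (hΓ : 2 * Fintype.card ((Fin m × Bool) × Lf) ≤ Γ.card)
    (hg : ∀ e ∈ Γ, B / 2 < fpr v σ e * X (edg v (Sum.inr e)))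
    (t : Fin m × Bool → Lf → ℝ) (ht : ∀ s j, t s j = 1 ∨ t s j = -1)
    (f : Fin m × Bool → ℝ) (hf : ∀ s, f s = ∑ j, t s j * X (edg v (Sum.inl (s, j))))
    (hpos : ∀ s, 0 < f s)
    (hsup : ∀ (l : ℕ) (h : l + 1 < m) (c : Bool),
      f (⟨l, by omega⟩, false) + f (⟨l, by omega⟩, true) < f (⟨l + 1, h⟩, c)) :
    ∃ L : List (Finset W), (∀ S ∈ L, S.card ≤ 3) ∧ Improving (gr v) X σ L ∧
        2 ^ m ≤ L.length + 1 := by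
  have hm1 : m - 1 < m := by omega
  obtain ⟨L1, c1, i1, h1⟩ := phase1 v X B hB
    (fun s j => if s = (⟨m - 1, hm1⟩, false) then t s j else - t s j)
    (by
      intro s j
      rcases ht s j with h | h <;> simp only [h] <;> split_ifs <;> simp) _ σ hσ Γ hΓ hg
      (Finset.card_le_univ _)
  obtain ⟨L2, c2, i2, h2, -⟩ := phase2 v X t f hf hpos hsup (m - 1) hm1 false (applyList σ L1)
    (by intro j; rw [h1]; simp)
    (by
      intro l' h' hlt c' j
      rw [h1, if_neg]
      simp only [Prod.mk.injEq, Fin.mk.injEq]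
      omega)
  refine ⟨L1 ++ L2, ?_, improving_append _ _ _ _ _ i1 i2, ?_⟩
  · intro T hT
    rcases List.mem_append.1 hT with hT | hT
    · exact c1 T hT
    · exact c2 T hT
  · rw [Nat.sub_add_cancel (by omega)] at h2
    simp only [List.length_append]; omega
end det2

lemma det_cells {Fu W : Type} [Fintype Fu] [Fintype W] (m k g : ℕ) (hm : 0 < m)
    (hg : g = 3 ^ m * (2 * k + 2)) (v : VT (Fin m × Bool) (Fin k × Bool) Fu ≃ W)
    (a b δ B : ℝ) (hab : a < b) (hδ : δ = (b - a) / ((4 * g : ℕ) : ℝ)) (hB : B = max |a| |b|)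
    (X : Sym2 W → ℝ) (σ : W → ℝ) (hσ : IsCut σ)
    (w : Fin m × Bool → Fin k → Fin (4 * g) × Fin (4 * g)) (hw : ∀ s, GoodU g k (w s))
    (h1 : ∀ s i, X (edg v (Sum.inl (s, (i, true)))) ∈
      Set.Ico (a + ((w s i).1 : ℕ) * δ) (a + (((w s i).1 : ℕ) + 1) * δ))
    (h2 : ∀ s i, X (edg v (Sum.inl (s, (i, false)))) ∈
      Set.Ico (a + ((w s i).2 : ℕ) * δ) (a + (((w s i).2 : ℕ) + 1) * δ))
    (Γ : Finset Fu) (hΓ : 8 * m * k ≤ Γ.card)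
    (hg' : ∀ e ∈ Γ, B / 2 < fpr v σ e * X (edg v (Sum.inr e))) :
    ∃ L : List (Finset W), (∀ S ∈ L, S.card ≤ 3) ∧ Improving (gr v) X σ L ∧
        2 ^ m ≤ L.length + 1 := by
  have h3m : 3 ≤ 3 ^ m := by
    calc 3 = 3 ^ 1 := by norm_num
      _ ≤ 3 ^ m := Nat.pow_le_pow_right (by norm_num) hm
  have hkg : k + 2 < g := by rw [hg]; nlinarith
  have hg0 : (0:ℝ) < ((4 * g : ℕ) : ℝ) := by
    have : 0 < 4 * g := by omega
    exact_mod_cast this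
  have hδ0 : 0 < δ := by rw [hδ]; exact div_pos (by linarith) hg0
  have hδG : ((4 * g : ℕ) : ℝ) * δ = b - a := by rw [hδ]; field_simp
  have hcell : ∀ (u : Fin (4 * g)) (y : ℝ),
      y ∈ Set.Ico (a + (u : ℕ) * δ) (a + ((u : ℕ) + 1) * δ) → |y| ≤ B := by
    intro u y hy
    have hu : ((u : ℕ) : ℝ) + 1 ≤ ((4 * g : ℕ) : ℝ) := by exact_mod_cast u.2
    have hu0 : (0:ℝ) ≤ ((u : ℕ) : ℝ) := by positivity
    have y1 : a ≤ y := by nlinarith [hy.1]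
    have y2 : y ≤ b := by nlinarith [hy.2]
    rw [hB]; exact abs_le_max_abs_abs y1 y2
  set η := δ * (2 * k + 2) with hη
  have hη0 : 0 < η := by positivity
  have key : ∀ s : Fin m × Bool, ∃ r : Fin k → ℝ, (∀ i, r i = 1 ∨ r i = -1) ∧
      3 ^ ((s.1 : ℕ) + 1) * η ≤ ∑ i, r i * (X (edg v (Sum.inl (s, (i, true)))) -
        X (edg v (Sum.inl (s, (i, false))))) ∧
      ∑ i, r i * (X (edg v (Sum.inl (s, (i, true)))) -
        X (edg v (Sum.inl (s, (i, false))))) ≤ 3 ^ ((s.1 : ℕ) + 1) * η + η := by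
    intro s
    refine star_dense g k hkg (w s) (hw s) a δ hδ0
      (fun i c => X (edg v (Sum.inl (s, (i, c))))) (h1 s) (h2 s) _ (by positivity) ?_
    have e1 : (3:ℝ) ^ ((s.1 : ℕ) + 1) ≤ 3 ^ m :=
      pow_le_pow_right₀ (by norm_num) s.1.2
    have e2 : (g : ℝ) * δ = 3 ^ m * η := by
      rw [hg, hη]; push_cast; ring
    rw [e2]
    exact mul_le_mul_of_nonneg_right e1 hη0.le
  choose r hr hr1 hr2 using key
  refine det_main v hm X σ hσ B ?_ Γ ?_ hg' (fun s j => if j.2 then r s j.1 else - r s j.1) ?_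
    (fun s => ∑ i, r s i * (X (edg v (Sum.inl (s, (i, true)))) -
        X (edg v (Sum.inl (s, (i, false)))))) ?_ ?_ ?_
  · rintro s ⟨i, c⟩
    cases c
    · exact hcell _ _ (h2 s i)
    · exact hcell _ _ (h1 s i)
  · refine le_trans (le_of_eq ?_) hΓ
    simp; ring
  · intro s j
    rcases hr s j.1 with h | h <;> simp only [h] <;> split_ifs <;> simp
  · intro s
    rw [Fintype.sum_prod_type]
    apply Finset.sum_congr rfl
    intro i _
    simp; ring
  · intro s
    exact lt_of_lt_of_le (by positivity) (hr1 s)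
  · intro l h c
    have a1 := hr2 (⟨l, by omega⟩, false)
    have a2 := hr2 (⟨l, by omega⟩, true)
    have a3 := hr1 (⟨l + 1, h⟩, c)
    simp only at a1 a2 a3
    refine lt_of_lt_of_le (lt_of_le_of_lt (add_le_add a1 a2) ?_) a3
    have : (3:ℝ) ≤ 3 ^ (l + 1) := by
      calc (3:ℝ) = 3 ^ 1 := by norm_num
        _ ≤ 3 ^ (l + 1) := pow_le_pow_right₀ (by norm_num) (by omega)
    rw [pow_succ (3:ℝ) (l + 1)]
    nlinarith

def cell (a δ : ℝ) (u : ℕ) : Set ℝ := Set.Ico (a + u * δ) (a + (u + 1) * δ)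

lemma cell_meas (a δ : ℝ) (u : ℕ) : MeasurableSet (cell a δ u) := measurableSet_Ico

lemma unif_cell (a b : ℝ) (hab : a < b) (G : ℕ) (u : Fin G) :
    uniformIcc a b (cell a ((b - a) / G) u) = ENNReal.ofReal (1 / G) := by
  have hG : 0 < G := lt_of_le_of_lt (Nat.zero_le _) u.2
  have hG' : (0:ℝ) < G := by exact_mod_cast hG
  have hu : ((u : ℕ) : ℝ) + 1 ≤ G := by exact_mod_cast u.2
  have hu0 : (0:ℝ) ≤ ((u : ℕ) : ℝ) := by positivity
  have hδ : 0 < (b - a) / G := div_pos (by linarith) hG'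
  have hδG : (G : ℝ) * ((b - a) / G) = b - a := by field_simp
  have hsub : cell a ((b - a) / G) u ⊆ Set.Icc a b := by
    intro y hy
    unfold cell at hy
    constructor
    · nlinarith [hy.1]
    · nlinarith [hy.2]
  unfold uniformIcc
  rw [Measure.smul_apply, Measure.restrict_apply (cell_meas _ _ _),
    Set.inter_eq_left.2 hsub, Real.volume_Icc]
  unfold cell
  rw [Real.volume_Ico, smul_eq_mul, ← ENNReal.ofReal_inv_of_pos (by linarith),
    ← ENNReal.ofReal_mul (by rw [inv_nonneg]; linarith)]
  congr 1
  have : b - a ≠ 0 := by linarith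
  field_simp
  ring

lemma unif_null (a b : ℝ) (hab : a < b) : uniformIcc a b (Set.Ico a b)ᶜ = 0 := by
  unfold uniformIcc
  rw [Measure.smul_apply, Measure.restrict_apply measurableSet_Ico.compl]
  have : (Set.Ico a b)ᶜ ∩ Set.Icc a b ⊆ {b} := by
    rintro y ⟨h1, h2⟩
    simp only [Set.mem_compl_iff, Set.mem_Ico, not_and, not_lt] at h1
    exact le_antisymm h2.2 (h1 h2.1)
  rw [measure_mono_null this (by simp)]
  simp

lemma exists_cell (a b : ℝ) (hab : a < b) (G : ℕ) (hG : 0 < G) (y : ℝ) (hy : y ∈ Set.Ico a b) :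
    ∃ u : Fin G, y ∈ cell a ((b - a) / G) u := by
  have hG' : (0:ℝ) < G := by exact_mod_cast hG
  have hδ : 0 < (b - a) / G := div_pos (by linarith) hG'
  have hq : 0 ≤ (y - a) / ((b - a) / G) := div_nonneg (by linarith [hy.1]) hδ.le
  have hlt : ⌊(y - a) / ((b - a) / G)⌋₊ < G := by
    rw [Nat.floor_lt hq, div_lt_iff₀ hδ]
    have : (G : ℝ) * ((b - a) / G) = b - a := by field_simp
    linarith [hy.2]
  refine ⟨⟨_, hlt⟩, ?_⟩
  have f1 := Nat.floor_le hq
  have f2 := Nat.lt_floor_add_one ((y - a) / ((b - a) / G))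
  rw [le_div_iff₀ hδ] at f1
  rw [div_lt_iff₀ hδ] at f2
  unfold cell
  constructor
  · simp only; linarith
  · simp only; linarith

section prob
variable {Ω : Type} [MeasurableSpace Ω] {P : Measure Ω} [IsProbabilityMeasure P]

lemma prob_cells {J : Type} [Fintype J] (x : J → Ω → ℝ) (hx : ∀ j, Measurable (x j))
    (hi : iIndepFun x P) (a b : ℝ) (hab : a < b) (hl : ∀ j, Measure.map (x j) P = uniformIcc a b)
    (G : ℕ) (u : J → Fin G) :
    P {ω | ∀ j, x j ω ∈ cell a ((b - a) / G) (u j)} =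
      ENNReal.ofReal ((1 / (G : ℝ)) ^ Fintype.card J) := by
  have h := hi.measure_inter_preimage_eq_mul Finset.univ
    (sets := fun j => cell a ((b - a) / G) (u j)) (fun j _ => cell_meas _ _ _)
  have e : {ω | ∀ j, x j ω ∈ cell a ((b - a) / G) (u j)} =
      ⋂ j ∈ (Finset.univ : Finset J), x j ⁻¹' cell a ((b - a) / G) (u j) := by
    ext ω; simp
  rw [e, h]
  have : ∀ j ∈ (Finset.univ : Finset J),
      P (x j ⁻¹' cell a ((b - a) / G) (u j)) = ENNReal.ofReal (1 / G) := by
    intro j _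
    rw [← Measure.map_apply (hx j) (cell_meas _ _ _), hl, unif_cell a b hab]
  rw [Finset.prod_congr rfl this, Finset.prod_const, Finset.card_univ, ENNReal.ofReal_pow]
  positivity

lemma star_bad (g k : ℕ) (hg : 0 < g) (x : Fin k × Bool → Ω → ℝ) (hx : ∀ j, Measurable (x j))
    (hi : iIndepFun x P) (a b : ℝ) (hab : a < b)
    (hl : ∀ j, Measure.map (x j) P = uniformIcc a b) :
    P {ω | ∃ w : Fin k → Fin (4 * g) × Fin (4 * g), ¬ GoodU g k w ∧
      ∀ i, x (i, true) ω ∈ cell a ((b - a) / ((4 * g : ℕ) : ℝ)) (w i).1 ∧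
        x (i, false) ω ∈ cell a ((b - a) / ((4 * g : ℕ) : ℝ)) (w i).2} ≤
      ENNReal.ofReal (2 * (k + 1) * ((29 / 32) ^ k * (3 * g) ^ 2)) := by
  set bad := Finset.univ.filter (fun w : Fin k → Fin (4 * g) × Fin (4 * g) => ¬ GoodU g k w)
    with hbad
  have hsub : {ω | ∃ w : Fin k → Fin (4 * g) × Fin (4 * g), ¬ GoodU g k w ∧
      ∀ i, x (i, true) ω ∈ cell a ((b - a) / ((4 * g : ℕ) : ℝ)) (w i).1 ∧
        x (i, false) ω ∈ cell a ((b - a) / ((4 * g : ℕ) : ℝ)) (w i).2} ⊆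
      ⋃ w ∈ bad, {ω | ∀ j : Fin k × Bool, x j ω ∈ cell a ((b - a) / ((4 * g : ℕ) : ℝ))
        ((if j.2 then (w j.1).1 else (w j.1).2 : Fin (4 * g)) : ℕ)} := by
    rintro ω ⟨w, hw, h⟩
    simp only [Set.mem_iUnion]
    refine ⟨w, by simp [hbad, hw], ?_⟩
    rintro ⟨i, c⟩
    cases c
    · exact (h i).2
    · exact (h i).1
  refine (measure_mono hsub).trans ((measure_biUnion_finset_le _ _).trans ?_)
  have : ∀ w ∈ bad, P {ω | ∀ j : Fin k × Bool, x j ω ∈ cell a ((b - a) / ((4 * g : ℕ) : ℝ))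
        ((if j.2 then (w j.1).1 else (w j.1).2 : Fin (4 * g)) : ℕ)} =
      ENNReal.ofReal ((1 / ((4 * g : ℕ) : ℝ)) ^ (k * 2)) := by
    intro w _
    rw [prob_cells x hx hi a b hab hl (4 * g) (fun j => if j.2 then (w j.1).1 else (w j.1).2)]
    simp
  rw [Finset.sum_congr rfl this, Finset.sum_const, nsmul_eq_mul, ← ENNReal.ofReal_natCast,
    ← ENNReal.ofReal_mul (by positivity)]
  apply ENNReal.ofReal_le_ofReal
  have hc := goodU_count g hg k
  rw [← hbad] at hc
  have hg' : (0:ℝ) < g := by exact_mod_cast hg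
  refine (mul_le_mul_of_nonneg_right hc (by positivity)).trans (le_of_eq ?_)
  push_cast
  rw [mul_comm k 2, pow_mul, mul_pow (29/32 : ℝ)]
  have e : ((4 * g : ℝ) ^ 2) ^ k * ((1 / (4 * g : ℝ)) ^ 2) ^ k = 1 := by
    rw [← mul_pow]
    have : ((4 * g : ℝ) ^ 2) * ((1 / (4 * g : ℝ)) ^ 2) = 1 := by field_simp
    rw [this, one_pow]
  linear_combination (2 * ((k:ℝ) + 1) * ((29 / 32) ^ k * (3 * g) ^ 2)) * e

def fgood {Fu : Type} (cs : Fin 8) (r : Bool) (c : Fu → Fin 8) (h : Fu → Bool → Bool) (e : Fu) :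
    Prop := c e = cs ∧ (xor (h e false) (h e true)) = r

lemma fgood_sum (cs : Fin 8) (r : Bool) :
    ∑ h : Bool → Bool, ∑ c : Fin 8,
      (if c = cs ∧ (xor (h false) (h true)) = r then (1/2 : ℝ) else 1) = 31 := by
  have h1 : ∀ h : Bool → Bool, ∑ c : Fin 8,
      (if c = cs ∧ (xor (h false) (h true)) = r then (1/2 : ℝ) else 1) =
      8 - if (xor (h false) (h true)) = r then 1/2 else 0 := by
    intro h
    by_cases hh : (xor (h false) (h true)) = r
    · simp only [hh, and_true, if_true]
      have : ∀ c : Fin 8, (if c = cs then (1/2 : ℝ) else 1) = 1 - if c = cs then 1/2 else 0 := by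
        intro c; split_ifs <;> norm_num
      simp only [this, Finset.sum_sub_distrib]
      simp
    · simp [hh]
  simp only [h1, Finset.sum_sub_distrib]
  rw [← Finset.sum_filter, Finset.sum_const, Finset.sum_const]
  have : (Finset.univ.filter (fun h : Bool → Bool => (xor (h false) (h true)) = r)).card = 2 := by
    cases r <;> decide
  rw [this]
  simp; norm_num

lemma fuel_count {Fu St Lf W : Type} [Fintype Fu] [Fintype St] [Fintype Lf] [Fintype W]
    (v : VT St Lf Fu ≃ W) (cs : Fin 8) (r : Bool) (z : ℕ) :
    ((Finset.univ.filter (fun y : (Fu → Fin 8) × (W → Bool) =>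
      (Finset.univ.filter (fgood cs r y.1 (fun e c => y.2 (fu v e c)))).card < z)).card : ℝ) ≤
      2 ^ z * (31 / 32) ^ Fintype.card Fu * (8 ^ Fintype.card Fu * 2 ^ Fintype.card W) := by
  set H : (Fu → Fin 8) → (Fu → Bool → Bool) → ℝ := fun c h =>
    ∏ e, (if c e = cs ∧ (xor (h e false) (h e true)) = r then (1/2 : ℝ) else 1) with hH
  have hHz : ∀ c h, H c h = (1/2) ^ (Finset.univ.filter (fgood cs r c h)).card := by
    intro c h
    rw [← Finset.prod_const, Finset.prod_filter]
    apply Finset.prod_congr rfl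
    intro e _
    by_cases hh : c e = cs ∧ (xor (h e false) (h e true)) = r
    · have h2 : fgood cs r c h e := hh
      rw [if_pos hh, if_pos h2]
    · have h2 : ¬ fgood cs r c h e := hh
      rw [if_neg hh, if_neg h2]
  have step1 : ((Finset.univ.filter (fun y : (Fu → Fin 8) × (W → Bool) =>
      (Finset.univ.filter (fgood cs r y.1 (fun e c => y.2 (fu v e c)))).card < z)).card : ℝ) ≤
      2 ^ z * ∑ y : (Fu → Fin 8) × (W → Bool), H y.1 (fun e c => y.2 (fu v e c)) := by
    rw [Finset.card_filter, Finset.mul_sum]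
    push_cast
    apply Finset.sum_le_sum
    intro y _
    refine le_of_le_of_eq ?_ (congrArg (fun q : ℝ => 2 ^ z * q)
      (hHz y.1 (fun e c => y.2 (fu v e c)))).symm
    split_ifs with hz
    · have : (1:ℝ) = 2 ^ z * (1/2) ^ z := by rw [← mul_pow]; norm_num
      refine this.le.trans ?_
      apply mul_le_mul_of_nonneg_left _ (by positivity)
      exact pow_le_pow_of_le_one (a := (1/2 : ℝ)) (by norm_num) (by norm_num) hz.le
    · positivity
  have step2 : ∑ y : (Fu → Fin 8) × (W → Bool), H y.1 (fun e c => y.2 (fu v e c)) =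
      2 ^ Fintype.card St * 2 ^ (Fintype.card (St × Lf)) * 31 ^ Fintype.card Fu := by
    rw [Fintype.sum_prod_type, Finset.sum_comm]
    have hin : ∀ h : Fu → Bool → Bool, ∑ c : Fu → Fin 8, H c h =
        ∏ e, ∑ c : Fin 8, (if c = cs ∧ (xor (h e false) (h e true)) = r then (1/2 : ℝ) else 1) := by
      intro h
      rw [Finset.prod_univ_sum]
      simp only [Fintype.piFinset_univ, hH]
    simp only [hin]
    set Q : (Bool → Bool) → ℝ := fun h =>
      ∑ c : Fin 8, (if c = cs ∧ (xor (h false) (h true)) = r then (1/2 : ℝ) else 1) with hQ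
    let E : (W → Bool) ≃ (St → Bool) × ((St × Lf → Bool) × (Fu → Bool → Bool)) :=
      (Equiv.arrowCongr v.symm (Equiv.refl Bool)).trans
        ((Equiv.sumArrowEquivProdArrow _ _ _).trans (Equiv.prodCongr (Equiv.refl _)
          ((Equiv.sumArrowEquivProdArrow _ _ _).trans (Equiv.prodCongr (Equiv.refl _)
            (Equiv.curry _ _ _)))))
    have : ∑ s : W → Bool, ∏ e, Q (fun c => s (fu v e c)) =
        ∑ y : (St → Bool) × ((St × Lf → Bool) × (Fu → Bool → Bool)), ∏ e, Q (y.2.2 e) := by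
      apply Fintype.sum_equiv E
      intro s
      rfl
    refine this.trans ?_
    have hfin : ∑ h : Fu → Bool → Bool, ∏ e, Q (h e) = 31 ^ Fintype.card Fu := by
      have h1 := Finset.prod_univ_sum (fun _ : Fu => (Finset.univ : Finset (Bool → Bool)))
        (fun _ h => Q h)
      rw [Fintype.piFinset_univ] at h1
      rw [← h1]
      simp only [hQ, fgood_sum]
      rw [Finset.prod_const, Finset.card_univ]
    rw [Fintype.sum_prod_type]
    simp only [Fintype.sum_prod_type, hfin]
    simp
    ring
  refine step1.trans (le_of_eq ?_)
  rw [step2]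
  have hcard : Fintype.card W = Fintype.card St + (Fintype.card (St × Lf) + Fintype.card Fu * 2) := by
    rw [← Fintype.card_congr v]
    simp
  rw [hcard, pow_add, pow_add, mul_comm (Fintype.card Fu) 2, pow_mul, div_pow]
  have e1 : (32:ℝ) ^ Fintype.card Fu = 8 ^ Fintype.card Fu * (2 ^ 2) ^ Fintype.card Fu := by
    rw [← mul_pow]; norm_num
  rw [e1]
  field_simp

lemma fuel_bad {Fu St Lf W : Type} [Fintype Fu] [Fintype St] [Fintype Lf] [Fintype W]
    (v : VT St Lf Fu ≃ W) (cs : Fin 8) (r : Bool) (z : ℕ)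
    (x : Fu → Ω → ℝ) (hx : ∀ j, Measurable (x j))
    (hi : iIndepFun x P) (a b : ℝ) (hab : a < b)
    (hl : ∀ j, Measure.map (x j) P = uniformIcc a b)
    (σb : Ω → W → Bool) (hσ : Measurable σb)
    (hσl : Measure.map σb P = (PMF.uniformOfFintype (W → Bool)).toMeasure)
    (hxs : IndepFun (fun ω e => x e ω) σb P) :
    P {ω | ∃ c : Fu → Fin 8, (∀ e, x e ω ∈ cell a ((b - a) / ((8 : ℕ) : ℝ)) (c e)) ∧
      (Finset.univ.filter (fgood cs r c (fun e d => σb ω (fu v e d)))).card < z} ≤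
      ENNReal.ofReal (2 ^ z * (31 / 32) ^ Fintype.card Fu) := by
  set bad := (Finset.univ.filter (fun y : (Fu → Fin 8) × (W → Bool) =>
      (Finset.univ.filter (fgood cs r y.1 (fun e c => y.2 (fu v e c)))).card < z)) with hbad
  have hsub : {ω | ∃ c : Fu → Fin 8, (∀ e, x e ω ∈ cell a ((b - a) / ((8 : ℕ) : ℝ)) (c e)) ∧
      (Finset.univ.filter (fgood cs r c (fun e d => σb ω (fu v e d)))).card < z} ⊆
      ⋃ y ∈ bad, {ω | ∀ e, x e ω ∈ cell a ((b - a) / ((8 : ℕ) : ℝ)) (y.1 e)} ∩ σb ⁻¹' {y.2} := by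
    rintro ω ⟨c, h1, h2⟩
    simp only [Set.mem_iUnion]
    refine ⟨(c, σb ω), ?_, h1, rfl⟩
    rw [hbad, Finset.mem_filter]
    exact ⟨Finset.mem_univ _, h2⟩
  refine (measure_mono hsub).trans ((measure_biUnion_finset_le _ _).trans ?_)
  have : ∀ y ∈ bad, P ({ω | ∀ e, x e ω ∈ cell a ((b - a) / ((8 : ℕ) : ℝ)) (y.1 e)} ∩ σb ⁻¹' {y.2}) =
      ENNReal.ofReal ((1 / 8) ^ Fintype.card Fu * (1 / 2) ^ Fintype.card W) := by
    intro y _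
    have hset : {ω | ∀ e, x e ω ∈ cell a ((b - a) / ((8 : ℕ) : ℝ)) (y.1 e)} =
        (fun ω e => x e ω) ⁻¹' (Set.univ.pi (fun e => cell a ((b - a) / ((8 : ℕ) : ℝ)) (y.1 e))) := by
      ext ω; simp
    have hp := prob_cells x hx hi a b hab hl 8 y.1
    rw [hset, hxs.measure_inter_preimage_eq_mul _ _
      (MeasurableSet.univ_pi (fun e => cell_meas _ _ _)) (measurableSet_singleton _), ← hset, hp,
      ← Measure.map_apply hσ (measurableSet_singleton _), hσl,
      PMF.toMeasure_apply_singleton _ _ (measurableSet_singleton _), PMF.uniformOfFintype_apply,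
      ENNReal.ofReal_mul (by positivity)]
    congr 1
    rw [Fintype.card_fun, Fintype.card_bool, one_div, inv_pow, ENNReal.ofReal_inv_of_pos (by positivity)]
    congr 1
    rw [ENNReal.ofReal_pow (by norm_num)]
    simp
  rw [Finset.sum_congr rfl this, Finset.sum_const, nsmul_eq_mul, ← ENNReal.ofReal_natCast,
    ← ENNReal.ofReal_mul (by positivity)]
  apply ENNReal.ofReal_le_ofReal
  have hc := fuel_count v cs r z
  rw [← hbad] at hc
  refine (mul_le_mul_of_nonneg_right hc (by positivity)).trans (le_of_eq ?_)
  rw [one_div, one_div, inv_pow, inv_pow]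
  field_simp
end prob

lemma fuel_choice (a b : ℝ) (hab : a < b) : ∃ (cs : Fin 8) (r : Bool),
    ∀ y ∈ cell a ((b - a) / ((8 : ℕ) : ℝ)) cs, ∀ p q : Bool, xor p q = r →
      max |a| |b| / 2 < ((if p then 1 else -1) * (if q then 1 else -1)) * y := by
  by_cases h : |a| ≤ b
  · refine ⟨7, false, ?_⟩
    intro y hy p q hpq
    have hb : 0 < b := by
      rw [abs_le] at h
      by_contra hb
      linarith [h.1]
    have h1 : max |a| |b| = b := by rw [abs_of_pos hb]; exact max_eq_right h
    have h2 : (if p then (1:ℝ) else -1) * (if q then 1 else -1) = 1 := by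
      cases p <;> cases q <;> simp_all
    rw [h1, h2]
    unfold cell at hy
    have hy1 := hy.1
    have h7 : (((7 : Fin 8) : ℕ) : ℝ) = 7 := by norm_num
    rw [h7] at hy1
    push_cast at hy1
    rw [abs_le] at h
    linarith [h.1]
  · refine ⟨0, true, ?_⟩
    push Not at h
    intro y hy p q hpq
    have ha : a < 0 := by
      by_contra ha
      rw [abs_of_nonneg (by linarith)] at h
      linarith
    rw [abs_of_neg ha] at h ⊢
    have h1 : max (-a) |b| = -a := by
      apply max_eq_left
      rw [abs_le]; constructor <;> linarith
    have h2 : (if p then (1:ℝ) else -1) * (if q then 1 else -1) = -1 := by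
      cases p <;> cases q <;> simp_all
    rw [h1, h2]
    unfold cell at hy
    have hy1 := hy.2
    have h7 : (((0 : Fin 8) : ℕ) : ℝ) = 0 := by norm_num
    rw [h7] at hy1
    push_cast at hy1
    linarith

lemma isCut_toCut {W : Type} (f : W → Bool) : IsCut (toCut f) := by
  intro x
  unfold toCut
  split_ifs <;> simp

lemma prob_main (m k g F : ℕ) (hm : 0 < m) (hg : g = 3 ^ m * (2 * k + 2)) {W : Type} [Fintype W]
    (v : VT (Fin m × Bool) (Fin k × Bool) (Fin F) ≃ W) (a b : ℝ) (hab : a < b)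
    {Ω : Type} [MeasurableSpace Ω] {P : Measure Ω} [IsProbabilityMeasure P]
    (X : (gr v).edgeSet → Ω → ℝ) (σb : Ω → (W → Bool))
    (hX : ∀ e, Measurable (X e)) (hI : iIndepFun X P)
    (hL : ∀ e, Measure.map (X e) P = uniformIcc a b) (hσ : Measurable σb)
    (hσl : Measure.map σb P = (PMF.uniformOfFintype (W → Bool)).toMeasure)
    (hXσ : IndepFun (fun ω e => X e ω) σb P) (Ev : Set Ω)
    (hEv : Ev = {ω | ∃ L : List (Finset W), (∀ S ∈ L, S.card ≤ 3) ∧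
      Improving (gr v) (fun e => if h : e ∈ (gr v).edgeSet then X ⟨e, h⟩ ω else 0)
        (toCut (σb ω)) L ∧ 2 ^ m ≤ L.length + 1}) :
    P Evᶜ ≤ ENNReal.ofReal (2 * m * (2 * (k + 1) * ((29 / 32) ^ k * (3 * g) ^ 2)) +
      2 ^ (8 * m * k) * (31 / 32) ^ F) := by
  have hg0 : 0 < g := by rw [hg]; positivity
  set ed : IT (Fin m × Bool) (Fin k × Bool) (Fin F) → (gr v).edgeSet :=
    fun i => ⟨edg v i, edg_mem v i⟩ with hed
  have hedi : Function.Injective ed := by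
    intro i j h
    exact edg_inj v (Subtype.ext_iff.1 h)
  set x : IT (Fin m × Bool) (Fin k × Bool) (Fin F) → Ω → ℝ := fun i => X (ed i) with hx
  have hxi : iIndepFun x P := hI.precomp hedi
  have hXe : ∀ (ω : Ω) i, (if h : edg v i ∈ (gr v).edgeSet then X ⟨edg v i, h⟩ ω else 0)
      = x i ω := by
    intro ω i
    rw [dif_pos (edg_mem v i)]
  obtain ⟨cs, r, hcs⟩ := fuel_choice a b hab
  set Nul : Set Ω := ⋃ i, x i ⁻¹' (Set.Ico a b)ᶜ with hNul
  set SB : Fin m × Bool → Set Ω := fun s =>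
    {ω | ∃ w : Fin k → Fin (4 * g) × Fin (4 * g), ¬ GoodU g k w ∧
      ∀ i, x (Sum.inl (s, (i, true))) ω ∈ cell a ((b - a) / ((4 * g : ℕ) : ℝ)) (w i).1 ∧
        x (Sum.inl (s, (i, false))) ω ∈ cell a ((b - a) / ((4 * g : ℕ) : ℝ)) (w i).2} with hSB
  set FB : Set Ω := {ω | ∃ c : Fin F → Fin 8,
      (∀ e, x (Sum.inr e) ω ∈ cell a ((b - a) / ((8 : ℕ) : ℝ)) (c e)) ∧
      (Finset.univ.filter (fgood cs r c (fun e d => σb ω (fu v e d)))).card < 8 * m * k} with hFB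
  have hNul0 : P Nul = 0 := by
    rw [hNul, measure_iUnion_null_iff]
    intro i
    rw [← Measure.map_apply (hX _) measurableSet_Ico.compl, hL, unif_null a b hab]
  have hSBle : ∀ s, P (SB s) ≤
      ENNReal.ofReal (2 * (k + 1) * ((29 / 32) ^ k * (3 * g) ^ 2)) := by
    intro s
    refine star_bad g k hg0 (fun j => x (Sum.inl (s, j))) (fun j => hX _) ?_ a b hab
      (fun j => hL _)
    exact hxi.precomp (g := fun j => Sum.inl (s, j)) (by intro i j h; simpa using h)
  have hFBle : P FB ≤ ENNReal.ofReal (2 ^ (8 * m * k) * (31 / 32) ^ F) := by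
    have := fuel_bad (P := P) v cs r (8 * m * k) (fun e => x (Sum.inr e)) (fun j => hX _)
      (hxi.precomp (g := fun j => Sum.inr j) (by intro i j h; simpa using h)) a b hab
      (fun j => hL _) σb hσ hσl
      (hXσ.comp (φ := fun y e => y (ed (Sum.inr e))) (ψ := id)
        (measurable_pi_lambda _ (fun e => measurable_pi_apply _)) measurable_id)
    rwa [Fintype.card_fin] at this
  have hsub : Evᶜ ⊆ Nul ∪ ((⋃ s, SB s) ∪ FB) := by
    intro ω hω
    by_contra hcon
    simp only [Set.mem_union, not_or] at hcon
    obtain ⟨hn, hs, hf⟩ := hcon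
    apply hω
    rw [hEv]
    have hico : ∀ i, x i ω ∈ Set.Ico a b := by
      intro i
      by_contra h
      exact hn (Set.mem_iUnion.2 ⟨i, h⟩)
    have hst : ∀ i, ∃ u : Fin (4 * g), x i ω ∈ cell a ((b - a) / ((4 * g : ℕ) : ℝ)) u :=
      fun i => exists_cell a b hab _ (by omega) _ (hico i)
    choose u hu using hst
    have hfc : ∀ e, ∃ c : Fin 8, x (Sum.inr e) ω ∈ cell a ((b - a) / ((8 : ℕ) : ℝ)) c :=
      fun i => exists_cell a b hab _ (by omega) _ (hico _)
    choose c hc using hfc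
    refine det_cells m k g hm hg v a b _ _ hab rfl rfl _ _ (isCut_toCut _)
      (fun s i => (u (Sum.inl (s, (i, true))), u (Sum.inl (s, (i, false))))) ?_ ?_ ?_
      (Finset.univ.filter (fgood cs r c (fun e d => σb ω (fu v e d)))) ?_ ?_
    · intro s
      by_contra hbad
      exact hs (Set.mem_iUnion.2 ⟨s, _, hbad, fun i => ⟨hu _, hu _⟩⟩)
    · intro s i
      rw [hXe]; exact hu _
    · intro s i
      rw [hXe]; exact hu _
    · by_contra hlt
      exact hf ⟨c, hc, not_le.1 hlt⟩
    · intro e he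
      have he := (Finset.mem_filter.1 he).2
      rw [hXe]
      refine hcs _ ?_ _ _ he.2
      have := hc e
      rwa [he.1] at this
  refine (measure_mono hsub).trans ((measure_union_le _ _).trans ?_)
  rw [hNul0, zero_add]
  refine (measure_union_le _ _).trans ?_
  rw [ENNReal.ofReal_add (by positivity) (by positivity)]
  refine add_le_add ?_ hFBle
  refine (measure_iUnion_fintype_le _ _).trans ?_
  refine (Finset.sum_le_sum (fun s _ => hSBle s)).trans ?_
  rw [Finset.sum_const, nsmul_eq_mul, ← ENNReal.ofReal_natCast,
    ← ENNReal.ofReal_mul (by positivity)]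
  apply ENNReal.ofReal_le_ofReal
  apply le_of_eq
  simp only [Finset.card_univ, Fintype.card_prod, Fintype.card_fin, Fintype.card_bool]
  push_cast
  ring

lemma asym_tend : Filter.Tendsto (fun m : ℕ => 39546000 * ((m : ℝ) ^ 4 * (9 * (29 / 32) ^ 64) ^ m) +
    (2 * (31 / 32) ^ 32) ^ m) Filter.atTop (nhds (0:ℝ)) := by
  have h1 : Filter.Tendsto (fun m : ℕ => (m : ℝ) ^ 4 * ((9 * (29 / 32) ^ 64 : ℝ)) ^ m)
      Filter.atTop (nhds 0) := by
    apply tendsto_pow_const_mul_const_pow_of_abs_lt_one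
    rw [abs_of_pos (by positivity)]
    norm_num
  have h2 : Filter.Tendsto (fun m : ℕ => ((2 * (31 / 32) ^ 32 : ℝ)) ^ m)
      Filter.atTop (nhds 0) := by
    apply tendsto_pow_atTop_nhds_zero_of_lt_one (by positivity)
    norm_num
  have := (h1.const_mul 39546000).add h2
  simpa using this

lemma asym_le (m k g F : ℕ) (hm : 0 < m) (hk : k = 64 * m) (hg : g = 3 ^ m * (2 * k + 2))
    (hF : F = 16384 * m ^ 2) :
    2 * (m : ℝ) * (2 * (k + 1) * ((29 / 32) ^ k * (3 * g) ^ 2)) +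
      2 ^ (8 * m * k) * (31 / 32) ^ F ≤
    39546000 * ((m : ℝ) ^ 4 * (9 * (29 / 32) ^ 64) ^ m) + (2 * (31 / 32) ^ 32) ^ m := by
  have hm1 : (1:ℝ) ≤ m := by exact_mod_cast hm
  apply add_le_add
  · have e1 : ((29 / 32 : ℝ)) ^ k = ((29 / 32) ^ 64) ^ m := by rw [hk, pow_mul]
    have e2 : (g : ℝ) = 3 ^ m * (2 * k + 2) := by rw [hg]; push_cast; ring
    have e3 : (k : ℝ) = 64 * m := by rw [hk]; push_cast; ring
    have e4 : ((3:ℝ) ^ m) ^ 2 = 9 ^ m := by rw [← pow_mul, mul_comm, pow_mul]; norm_num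
    set Q : ℝ := ((29 / 32 : ℝ) ^ 64) ^ m with hQ
    have hQ0 : 0 < Q := by positivity
    have e5 : 2 * (m : ℝ) * (2 * (k + 1) * ((29 / 32) ^ k * (3 * g) ^ 2)) =
        (36 * m * (64 * m + 1) * (128 * m + 2) ^ 2) * (9 ^ m * Q) := by
      rw [e1, e2, ← e4, e3]; ring
    have e6 : 39546000 * ((m : ℝ) ^ 4 * (9 * (29 / 32) ^ 64) ^ m) =
        (36 * m * (65 * m) * (130 * m) ^ 2) * (9 ^ m * Q) := by
      rw [mul_pow, hQ]; ring
    rw [e5, e6]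
    apply mul_le_mul_of_nonneg_right _ (by positivity)
    gcongr
    · linarith
    · linarith
  · have e1 : (2:ℝ) ^ (8 * m * k) * (31 / 32) ^ F = (2 * (31 / 32) ^ 32) ^ (512 * m ^ 2) := by
      rw [mul_pow, ← pow_mul, hF, hk]
      congr 2 <;> ring
    rw [e1]
    apply pow_le_pow_of_le_one (by positivity) (by norm_num)
    nlinarith

lemma len_bound (n m len : ℕ) (hmn : m = Nat.sqrt n) (hm : 2 ≤ m) (h : 2 ^ m ≤ len + 1) :
    (2 : ℝ) ^ ((1 / 4 : ℝ) * Real.sqrt n) ≤ (len : ℝ) := by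
  obtain ⟨p, rfl⟩ : ∃ p, m = p + 1 := ⟨m - 1, by omega⟩
  have h1 : 2 ^ p ≤ len := by
    rw [pow_succ] at h
    have : 1 ≤ 2 ^ p := Nat.one_le_two_pow
    omega
  have h2 : Real.sqrt n ≤ p + 2 := by
    rw [Real.sqrt_le_left (by positivity)]
    have := Nat.lt_succ_sqrt n
    rw [← hmn] at this
    have h3 : n ≤ (p + 2) ^ 2 := by rw [pow_two]; exact this.le
    exact_mod_cast h3
  have hp : (1:ℝ) ≤ p := by
    have : 1 ≤ p := by omega
    exact_mod_cast this
  calc (2 : ℝ) ^ ((1 / 4 : ℝ) * Real.sqrt n) ≤ (2:ℝ) ^ (p : ℝ) := by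
        apply Real.rpow_le_rpow_of_exponent_le (by norm_num)
        linarith
    _ = (2:ℝ) ^ p := Real.rpow_natCast 2 p
    _ ≤ len := by exact_mod_cast h1

abbrev VM (m : ℕ) := VT (Fin m × Bool) (Fin (64 * m) × Bool) (Fin (16384 * m ^ 2))
noncomputable def vm (m : ℕ) : VM m ≃ Fin (Fintype.card (VM m)) := Fintype.equivFin _

lemma card_VM (m : ℕ) : Fintype.card (VM m) ≤ 40000 * m ^ 2 := by
  simp only [Fintype.card_sum, Fintype.card_prod, Fintype.card_fin, Fintype.card_bool]
  nlinarith


/-- There are `c, C > 0` and fixed graphs `G_n` on at most `C·n` vertices such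
that for all reals `a < b`, with independent uniform `[a, b]` edge weights and an independent
uniformly random cut, the probability that there is an improving 3-flip sequence of length at
least `2^{c·√n}` tends to `1` as `n → ∞`. -/
theorem three_flip_smoothed_superpolynomial :
    ∃ c : ℝ, 0 < c ∧ ∃ C : ℝ, 0 < C ∧
      ∃ (N : ℕ → ℕ) (G : ∀ n, SimpleGraph (Fin (N n))),
        (∀ n : ℕ, (N n : ℝ) ≤ C * n) ∧
        ∀ a b : ℝ, a < b →
          ∀ ε : ℝ, 0 < ε → ∃ M : ℕ, ∀ n : ℕ, M ≤ n →
            ∀ (Ω : Type) (_ : MeasurableSpace Ω) (P : Measure Ω), IsProbabilityMeasure P →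
              ∀ (X : (G n).edgeSet → Ω → ℝ) (σb : Ω → (Fin (N n) → Bool)),
                (∀ e, Measurable (X e)) →
                iIndepFun X P →
                (∀ e, Measure.map (X e) P = uniformIcc a b) →
                Measurable σb →
                Measure.map σb P = (PMF.uniformOfFintype (Fin (N n) → Bool)).toMeasure →
                IndepFun (fun ω e => X e ω) σb P →
                ENNReal.ofReal (1 - ε) ≤
                  P {ω | ∃ L : List (Finset (Fin (N n))),
                    (∀ S ∈ L, S.card ≤ 3) ∧
                    Improving (G n)
                      (fun e => if h : e ∈ (G n).edgeSet then X ⟨e, h⟩ ω else 0)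
                      (toCut (σb ω)) L ∧
                    (2 : ℝ) ^ (c * Real.sqrt n) ≤ (L.length : ℝ)} := by
  refine ⟨1 / 4, by norm_num, 40000, by norm_num, fun n => Fintype.card (VM (Nat.sqrt n)),
    fun n => gr (vm (Nat.sqrt n)), ?_, ?_⟩
  · intro n
    have h1 := card_VM (Nat.sqrt n)
    have h2 := Nat.sqrt_le' n
    have h3 : Fintype.card (VM (Nat.sqrt n)) ≤ 40000 * n := by nlinarith
    exact_mod_cast h3
  · intro a b hab ε hε
    obtain ⟨M0, hM0⟩ := Filter.eventually_atTop.1 (asym_tend.eventually (gt_mem_nhds hε))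
    refine ⟨(max M0 2) ^ 2, ?_⟩
    intro n hn Ω _ P hP X σb hX hI hL hσ hσl hXσ
    have hmn : max M0 2 ≤ Nat.sqrt n := by
      rw [Nat.le_sqrt']; exact hn
    have hm2 : 2 ≤ Nat.sqrt n := (le_max_right _ _).trans hmn
    have hm0 : 0 < Nat.sqrt n := by omega
    have hlt := hM0 _ ((le_max_left _ _).trans hmn)
    have hle := asym_le (Nat.sqrt n) _ _ _ hm0 rfl rfl rfl
    obtain ⟨Ev, hEv⟩ : ∃ Ev : Set Ω, Ev = {ω | ∃ L : List (Finset (Fin (Fintype.card (VM (Nat.sqrt n))))),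
        (∀ S ∈ L, S.card ≤ 3) ∧
        Improving (gr (vm (Nat.sqrt n))) (fun e => if h : e ∈ (gr (vm (Nat.sqrt n))).edgeSet then
          X ⟨e, h⟩ ω else 0) (toCut (σb ω)) L ∧ 2 ^ (Nat.sqrt n) ≤ L.length + 1} := ⟨_, rfl⟩
    have hpm := prob_main (Nat.sqrt n) _ _ _ hm0 rfl (vm (Nat.sqrt n)) a b hab X σb hX hI hL hσ
      (by convert hσl) hXσ Ev hEv
    have hpe := hpm.trans (ENNReal.ofReal_le_ofReal (hle.trans hlt.le))
    rw [ENNReal.ofReal_sub _ hε.le, ENNReal.ofReal_one, tsub_le_iff_right]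
    have h1 : 1 ≤ P Ev + P Evᶜ := by
      rw [← measure_univ (μ := P), ← Set.union_compl_self Ev]
      exact measure_union_le _ _
    refine h1.trans (add_le_add (measure_mono ?_) hpe)
    intro ω hω
    rw [hEv] at hω
    obtain ⟨L, h1, h2, h3⟩ := hω
    exact ⟨L, h1, h2, len_bound n _ _ rfl hm2 h3⟩

end MaxCut
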